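/- The axiom system A1, A2, A3, A4 of Łukasiewicz's infinite-valued sentential calculus, with condensed detachment as the sole rule of inference, admits strong double-negation elimination. -/

import Mathlib

/-- Propositional formulas built from countably many variables by implication `i`
and negation `n`. -/
inductive Fm : Type
  | var : ℕ → Fm
  | i : Fm → Fm → Fm
  | n : Fm → Fm
  deriving DecidableEq

namespace Fm

/-- Homomorphic extension of a substitution (of formulas for variables). -/
def subst (σ : ℕ → Fm) : Fm → Fm
  | var k => σ k
  | i a b => i (subst σ a) (subst σ b)
  | n a => n (subst σ a)

/-- The (finite) set of variables occurring in a formula. -/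
def vars : Fm → Finset ℕ
  | var k => {k}
  | i a b => vars a ∪ vars b
  | n a => vars a

/-- `Sub s t` : `s` is a (not necessarily proper) subformula of `t`. -/
inductive Sub : Fm → Fm → Prop
  | refl (t : Fm) : Sub t t
  | il {s a b : Fm} : Sub s a → Sub s (i a b)
  | ir {s a b : Fm} : Sub s b → Sub s (i a b)
  | neg {s a : Fm} : Sub s a → Sub s (n a)

end Fm

/-- The renaming substitution induced by a permutation of the variables. -/
def renameSubst (p : Equiv.Perm ℕ) : ℕ → Fm := fun k => Fm.var (p k)

/-- `AlphVar A B` : `B` is an alphabetic variant of `A`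
(obtained from `A` by an injective renaming of variables). -/
def AlphVar (A B : Fm) : Prop := ∃ p : Equiv.Perm ℕ, B = A.subst (renameSubst p)

/-- `σ` unifies `A` and `C`. -/
def Unifies (σ : ℕ → Fm) (A C : Fm) : Prop := A.subst σ = C.subst σ

/-- `σ` is a most general unifier of `A` and `C`. -/
def IsMGU (σ : ℕ → Fm) (A C : Fm) : Prop :=
  Unifies σ A C ∧ ∀ τ : ℕ → Fm, Unifies τ A C → ∃ ρ : ℕ → Fm, ∀ k, τ k = (σ k).subst ρ

/-- Condensed detachment: from the major premiss `maj = i(A,B)` and minor premiss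
`minor` (renamed to `C`, sharing no variables with the major premiss), if `σ` is a
most general unifier of `A` and `C`, conclude `Bσ` (up to renaming of variables). -/
def CD (maj minor concl : Fm) : Prop :=
  ∃ (A B C : Fm) (σ : ℕ → Fm),
    maj = Fm.i A B ∧ AlphVar minor C ∧ Disjoint (Fm.i A B).vars C.vars ∧
    IsMGU σ A C ∧ AlphVar (B.subst σ) concl

/-- A formula contains a double negation if it has a subformula of the form `n(n(t))`. -/
def ContainsDN (A : Fm) : Prop := ∃ t : Fm, Fm.Sub (Fm.n (Fm.n t)) A

/-- Existence of a condensed-detachment proof from axiom set `L` in which every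
*deduced* (non-axiom) step satisfies the predicate `allowed`.  A step is an
alphabetic variant of an axiom of `L` or follows from two earlier steps by
condensed detachment. -/
inductive CDProof (L : Set Fm) (allowed : Fm → Prop) : Fm → Prop
  | ax {a b : Fm} : a ∈ L → AlphVar a b → CDProof L allowed b
  | cd {p q c : Fm} : CDProof L allowed p → CDProof L allowed q → CD p q c → allowed c →
      CDProof L allowed c

/-- `B` is provable from `L` by condensed detachment. -/
def CDProvable (L : Set Fm) (B : Fm) : Prop := CDProof L (fun _ => True) B

/-- A formula is double-negation free. -/
def DNFree (f : Fm) : Prop := ¬ ContainsDN f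

/-- `B` has a double-negation-free condensed-detachment proof from `L`
(no deduced step contains a double negation). -/
def DNFreeCDProvable (L : Set Fm) (B : Fm) : Prop := CDProof L DNFree B

/-- Every doubly negated subformula of `f` is (an alphabetic variant of) a doubly
negated subformula of `B`. -/
def DNOk (B : Fm) : Fm → Prop := fun f =>
  ∀ t : Fm, Fm.Sub (Fm.n (Fm.n t)) f → ∃ s : Fm, Fm.Sub (Fm.n (Fm.n s)) B ∧ AlphVar s t

/-- Existence of a proof from axioms `L` and (variable-free) assumptions `Δ` using
modus ponens and substitution, in which every deduced step satisfies `allowed`. -/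
inductive HProof (L Δ : Set Fm) (allowed : Fm → Prop) : Fm → Prop
  | ax {a : Fm} : a ∈ L → HProof L Δ allowed a
  | hyp {a : Fm} : a ∈ Δ → HProof L Δ allowed a
  | mp {a b : Fm} : HProof L Δ allowed (Fm.i a b) → HProof L Δ allowed a → allowed b →
      HProof L Δ allowed b
  | subst {a : Fm} (σ : ℕ → Fm) : HProof L Δ allowed a → allowed (a.subst σ) →
      HProof L Δ allowed (a.subst σ)

/-- Existence of a proof by modus ponens only from the set `S` of premisses, in which
every deduced step satisfies `allowed`. -/
inductive MPProof (S : Set Fm) (allowed : Fm → Prop) : Fm → Prop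
  | prem {a : Fm} : a ∈ S → MPProof S allowed a
  | mp {a b : Fm} : MPProof S allowed (Fm.i a b) → MPProof S allowed a → allowed b →
      MPProof S allowed b

/-- The set of substitution instances of members of `L`. -/
def SubstInstances (L : Set Fm) : Set Fm := {b | ∃ a ∈ L, ∃ σ : ℕ → Fm, b = a.subst σ}

/-- A formula containing no variables. -/
def VarFree (A : Fm) : Prop := A.vars = ∅

/-- Replace all occurrences of the selected doubly negated subformulas `n(n(q))`
(`q ∈ S`) by `q`. -/
def eraseDN (S : Finset Fm) : Fm → Fm
  | .var k => .var k
  | .i a b => .i (eraseDN S a) (eraseDN S b)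
  | .n (.var k) => .n (.var k)
  | .n (.i a b) => .n (.i (eraseDN S a) (eraseDN S b))
  | .n (.n q) => if q ∈ S then eraseDN S q else .n (eraseDN S (.n q))

/-- `L` admits strong double-negation elimination: whenever `B` is provable from `L`
by condensed detachment and `B*` is obtained from `B` by erasing all occurrences of
a chosen set of doubly negated subformulas of `B`, then `B*` has a condensed-detachment
proof from `L` whose deduced steps contain no doubly negated subformulas other than
(alphabetic variants of) those occurring in `B*`. -/
def StrongDNE (L : Set Fm) : Prop :=
  ∀ (B : Fm) (S : Finset Fm), CDProvable L B → (∀ q ∈ S, Fm.Sub (.n (.n q)) B) →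
    CDProof L (DNOk (eraseDN S B)) (eraseDN S B)

/-- Replace every occurrence of the variable `v` by `n(v)` and cancel the resulting
double negations. -/
def flipNeg (v : ℕ) : Fm → Fm
  | .var k => if k = v then .n (.var v) else .var k
  | .i a b => .i (flipNeg v a) (flipNeg v b)
  | .n a => if a = .var v then .var v else .n (flipNeg v a)

/-- Membership in `L*`: the closure of `L` under the operation of replacing a
negated variable `x` (i.e. one with `n(x)` occurring) everywhere by `n(x)`,
cancelling resulting double negations. -/
inductive StarMem (L : Set Fm) : Fm → Prop
  | base {a : Fm} : a ∈ L → StarMem L a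
  | step {a : Fm} {v : ℕ} : StarMem L a → Fm.Sub (.n (.var v)) a → StarMem L (flipNeg v a)

/-- D1 = i(x,x) -/
def D1 : Fm := .i (.var 0) (.var 0)
/-- D2 = i(i(x,x),i(n(x),n(x))) -/
def D2 : Fm := .i (.i (.var 0) (.var 0)) (.i (.n (.var 0)) (.n (.var 0)))
/-- D3 = i(i(x,x),i(i(y,y),i(i(x,y),i(x,y)))) -/
def D3 : Fm := .i (.i (.var 0) (.var 0))
  (.i (.i (.var 1) (.var 1)) (.i (.i (.var 0) (.var 1)) (.i (.var 0) (.var 1))))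

/-- L1 = i(i(x,y),i(i(y,z),i(x,z))) -/
def L1 : Fm := .i (.i (.var 0) (.var 1)) (.i (.i (.var 1) (.var 2)) (.i (.var 0) (.var 2)))
/-- L2 = i(i(n(x),x),x) -/
def L2 : Fm := .i (.i (.n (.var 0)) (.var 0)) (.var 0)
/-- L3 = i(x,i(n(x),y)) -/
def L3 : Fm := .i (.var 0) (.i (.n (.var 0)) (.var 1))
/-- L4 = i(i(x,n(x)),n(x)) -/
def L4 : Fm := .i (.i (.var 0) (.n (.var 0))) (.n (.var 0))
/-- L5 = i(n(x),i(x,y)) -/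
def L5 : Fm := .i (.n (.var 0)) (.i (.var 0) (.var 1))
/-- The Łukasiewicz axiom system for two-valued propositional calculus. -/
def Lax : Set Fm := {L1, L2, L3}

/-- A1 = i(x,i(y,x)) -/
def A1 : Fm := .i (.var 0) (.i (.var 1) (.var 0))
/-- A2 = i(i(x,y),i(i(y,z),i(x,z))) -/
def A2 : Fm := .i (.i (.var 0) (.var 1)) (.i (.i (.var 1) (.var 2)) (.i (.var 0) (.var 2)))
/-- A3 = i(i(i(x,y),y),i(i(y,x),x)) -/
def A3 : Fm := .i (.i (.i (.var 0) (.var 1)) (.var 1)) (.i (.i (.var 1) (.var 0)) (.var 0))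
/-- A4 = i(i(n(x),n(y)),i(y,x)) -/
def A4 : Fm := .i (.i (.n (.var 0)) (.n (.var 1))) (.i (.var 1) (.var 0))
/-- A6 = i(i(x,y),i(n(y),n(x))) -/
def A6 : Fm := .i (.i (.var 0) (.var 1)) (.i (.n (.var 1)) (.n (.var 0)))
/-- A7 = i(i(n(x),y),i(n(y),x)) -/
def A7 : Fm := .i (.i (.n (.var 0)) (.var 1)) (.i (.n (.var 1)) (.var 0))
/-- A8 = i(i(x,n(y)),i(y,n(x))) -/
def A8 : Fm := .i (.i (.var 0) (.n (.var 1))) (.i (.var 1) (.n (.var 0)))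
/-- The axiom system of Łukasiewicz's infinite-valued sentential calculus. -/
def Aax : Set Fm := {A1, A2, A3, A4}

/-- H1 = i(x,i(y,x)) -/
def H1 : Fm := .i (.var 0) (.i (.var 1) (.var 0))
/-- H2 = i(i(x,i(y,z)),i(i(x,y),i(x,z))) -/
def H2 : Fm := .i (.i (.var 0) (.i (.var 1) (.var 2)))
  (.i (.i (.var 0) (.var 1)) (.i (.var 0) (.var 2)))
/-- H3 = i(i(x,n(x)),n(x)) -/
def H3 : Fm := .i (.i (.var 0) (.n (.var 0))) (.n (.var 0))
/-- H4 = i(x,i(n(x),y)) -/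
def H4 : Fm := .i (.var 0) (.i (.n (.var 0)) (.var 1))
/-- The intuitionistic axiom system H. -/
def Hax : Set Fm := {H1, H2, H3, H4}

namespace Fm

theorem subst_congr {σ τ : ℕ → Fm} {a : Fm} (h : ∀ k ∈ a.vars, σ k = τ k) :
    a.subst σ = a.subst τ := by
  induction a with
  | var k => exact h k (by simp [vars])
  | i a b iha ihb =>
    simp only [subst]
    rw [iha fun k hk => h k (by simp [vars, hk]), ihb fun k hk => h k (by simp [vars, hk])]
  | n a iha => simp only [subst]; rw [iha h]

theorem eq_of_subst_eq {σ τ : ℕ → Fm} {a : Fm} (h : a.subst σ = a.subst τ) :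
    ∀ k ∈ a.vars, σ k = τ k := by
  induction a with
  | var k => simpa [vars, subst] using h
  | i a b iha ihb =>
    simp only [subst, i.injEq] at h
    intro k hk
    rcases Finset.mem_union.1 hk with hk | hk
    exacts [iha h.1 k hk, ihb h.2 k hk]
  | n a iha => simp only [subst, n.injEq] at h; exact iha h

theorem subst_subst (σ τ : ℕ → Fm) (a : Fm) :
    (a.subst σ).subst τ = a.subst fun k => (σ k).subst τ := by
  induction a <;> simp_all [subst]

@[simp] theorem subst_var (a : Fm) : a.subst var = a := by
  induction a <;> simp_all [subst]

theorem vars_subst (σ : ℕ → Fm) (a : Fm) :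
    (a.subst σ).vars = a.vars.biUnion fun k => (σ k).vars := by
  induction a <;> simp_all [subst, vars, Finset.union_biUnion]

/-- The number of symbols of a formula. -/
def size : Fm → ℕ
  | var _ => 1
  | i a b => size a + size b + 1
  | n a => size a + 1

theorem size_le_of_mem_vars {x : ℕ} {t : Fm} (τ : ℕ → Fm) (h : x ∈ t.vars) :
    (τ x).size ≤ (t.subst τ).size := by
  induction t with
  | var k => simp_all [vars, subst]
  | i a b iha ihb =>
    simp only [subst, size]
    rcases Finset.mem_union.1 h with h | h
    · have := iha h; omega
    · have := ihb h; omega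
  | n a iha => have := iha h; simp only [subst, size]; omega

theorem size_lt_of_mem_vars {x : ℕ} {t : Fm} (τ : ℕ → Fm) (h : x ∈ t.vars) (ht : t ≠ var x) :
    (τ x).size < (t.subst τ).size := by
  cases t with
  | var k => simp_all [vars]
  | i a b =>
    simp only [subst, size]
    rcases Finset.mem_union.1 h with h | h
    all_goals have := size_le_of_mem_vars τ h; omega
  | n a => have := size_le_of_mem_vars τ (t := a) h; simp only [subst, size]; omega

/-- The substitution of `t` for the variable `x`. -/
def single (x : ℕ) (t : Fm) : ℕ → Fm := fun k => if k = x then t else var k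

theorem subst_single_of_notMem {x : ℕ} {t a : Fm} (h : x ∉ a.vars) :
    a.subst (single x t) = a := by
  conv_rhs => rw [← subst_var a]
  exact subst_congr fun k hk => if_neg (by rintro rfl; exact h hk)

theorem subst_single_subst {x : ℕ} {t : Fm} {τ : ℕ → Fm} (h : τ x = t.subst τ) (a : Fm) :
    (a.subst (single x t)).subst τ = a.subst τ := by
  rw [subst_subst]
  refine subst_congr fun k _ => ?_
  by_cases hk : k = x
  · simp [single, hk, h]
  · simp [single, hk, subst]

theorem vars_subst_single_subset (x : ℕ) (t a : Fm) :
    (a.subst (single x t)).vars ⊆ (a.vars.erase x) ∪ t.vars := by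
  intro y hy
  rw [vars_subst, Finset.mem_biUnion] at hy
  obtain ⟨k, hk, hy⟩ := hy
  by_cases e : k = x
  · simp_all [single]
  · simp_all [single, vars]

end Fm

/-! ### Unification -/

/-- `τ` unifies every equation of the list `E`. -/
def UnifiesAll (τ : ℕ → Fm) (E : List (Fm × Fm)) : Prop :=
  ∀ e ∈ E, e.1.subst τ = e.2.subst τ

/-- The variables of a list of equations. -/
def eqsVars (E : List (Fm × Fm)) : Finset ℕ :=
  E.foldr (fun e s => e.1.vars ∪ e.2.vars ∪ s) ∅

/-- The total size of a list of equations. -/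
def eqsSize (E : List (Fm × Fm)) : ℕ :=
  (E.map fun e => e.1.size + e.2.size).sum

/-- Apply a substitution to both sides of every equation. -/
def eqsSubst (σ : ℕ → Fm) (E : List (Fm × Fm)) : List (Fm × Fm) :=
  E.map fun e => (e.1.subst σ, e.2.subst σ)

@[simp] theorem unifiesAll_nil (τ : ℕ → Fm) : UnifiesAll τ [] := by simp [UnifiesAll]

@[simp] theorem unifiesAll_cons {τ : ℕ → Fm} {a b : Fm} {E : List (Fm × Fm)} :
    UnifiesAll τ ((a, b) :: E) ↔ a.subst τ = b.subst τ ∧ UnifiesAll τ E := by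
  simp [UnifiesAll]

theorem unifiesAll_eqsSubst {σ τ : ℕ → Fm} {E : List (Fm × Fm)} :
    UnifiesAll τ (eqsSubst σ E) ↔ UnifiesAll (fun k => (σ k).subst τ) E := by
  simp only [UnifiesAll, eqsSubst, List.forall_mem_map, Fm.subst_subst]

theorem unifiesAll_eqsSubst_single {x : ℕ} {t : Fm} {τ : ℕ → Fm} {E : List (Fm × Fm)}
    (h : τ x = t.subst τ) : UnifiesAll τ (eqsSubst (Fm.single x t) E) ↔ UnifiesAll τ E := by
  simp only [UnifiesAll, eqsSubst, List.forall_mem_map, Fm.subst_single_subst h]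

theorem eqsVars_eqsSubst_single_subset (x : ℕ) (t : Fm) (E : List (Fm × Fm)) :
    eqsVars (eqsSubst (Fm.single x t) E) ⊆ (eqsVars E).erase x ∪ t.vars := by
  induction E with
  | nil => simp [eqsVars, eqsSubst]
  | cons e E ih =>
    intro y hy
    have h1 := @Fm.vars_subst_single_subset x t e.1 y
    have h2 := @Fm.vars_subst_single_subset x t e.2 y
    have h3 := @ih y
    simp only [eqsVars, eqsSubst, List.map_cons, List.foldr_cons, Finset.mem_union,
      Finset.mem_erase] at h1 h2 h3 hy ⊢
    tauto

/-- `σ` is an idempotent most general unifier of `E`. -/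
def IsIdemMGU (σ : ℕ → Fm) (E : List (Fm × Fm)) : Prop :=
  UnifiesAll σ E ∧ ∀ τ, UnifiesAll τ E → ∀ k, τ k = (σ k).subst τ

theorem IsIdemMGU.of_iff {σ : ℕ → Fm} {E E' : List (Fm × Fm)}
    (h : ∀ τ, UnifiesAll τ E ↔ UnifiesAll τ E') (hσ : IsIdemMGU σ E') : IsIdemMGU σ E :=
  ⟨(h σ).2 hσ.1, fun τ hτ => hσ.2 τ ((h τ).1 hτ)⟩

theorem IsIdemMGU.elim {x : ℕ} {t : Fm} {σ : ℕ → Fm} {E : List (Fm × Fm)} (hx : x ∉ t.vars)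
    (hσ : IsIdemMGU σ (eqsSubst (Fm.single x t) E)) :
    IsIdemMGU (fun k => (Fm.single x t k).subst σ) ((.var x, t) :: E) := by
  refine ⟨?_, fun τ hτ k => ?_⟩
  · rw [unifiesAll_cons]
    refine ⟨?_, unifiesAll_eqsSubst.1 hσ.1⟩
    rw [← Fm.subst_subst, ← Fm.subst_subst, Fm.subst_single_of_notMem hx]
    simp [Fm.subst, Fm.single]
  · rw [unifiesAll_cons] at hτ
    have h1 := hσ.2 τ ((unifiesAll_eqsSubst_single hτ.1).2 hτ.2)
    have h2 := Fm.subst_single_subst hτ.1 (.var k)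
    simp only [Fm.subst] at h2
    rw [Fm.subst_subst, ← h2]
    exact Fm.subst_congr fun j _ => h1 j

theorem eqsVars_elim_lt {x : ℕ} {t : Fm} (E : List (Fm × Fm)) (hx : x ∉ t.vars) :
    (eqsVars (eqsSubst (Fm.single x t) E)).card < (eqsVars ((.var x, t) :: E)).card := by
  refine Finset.card_lt_card (Finset.ssubset_iff_of_subset ?_ |>.2 ⟨x, ?_, fun h => ?_⟩)
  · refine (eqsVars_eqsSubst_single_subset x t E).trans fun y hy => ?_
    simp only [eqsVars, List.foldr_cons, Finset.mem_union, Finset.mem_erase] at hy ⊢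
    tauto
  · simp [eqsVars, Fm.vars]
  · simpa [hx] using eqsVars_eqsSubst_single_subset x t E h

theorem exists_isIdemMGU (E : List (Fm × Fm)) (h : ∃ τ, UnifiesAll τ E) :
    ∃ σ, IsIdemMGU σ E := by
  have elim : ∀ (x : ℕ) (t : Fm) (E' : List (Fm × Fm)),
      (eqsVars ((.var x, t) :: E')).card ≤ (eqsVars E).card →
      eqsSize E' < eqsSize E → (∃ τ, UnifiesAll τ ((.var x, t) :: E')) →
      ∃ σ, IsIdemMGU σ ((.var x, t) :: E') := by
    rintro x t E' hc hs ⟨τ, hτ⟩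
    rw [unifiesAll_cons] at hτ
    by_cases ht : t = .var x
    · subst ht
      have hc' : (eqsVars E').card ≤ (eqsVars E).card :=
        (Finset.card_le_card (by simp [eqsVars])).trans hc
      obtain ⟨σ, hσ⟩ := exists_isIdemMGU E' ⟨τ, hτ.2⟩
      exact ⟨σ, hσ.of_iff fun τ => by simp⟩
    · have hx : x ∉ t.vars := fun hx => by
        have := Fm.size_lt_of_mem_vars τ hx ht
        rw [← hτ.1] at this
        exact lt_irrefl _ this
      have hc' := (eqsVars_elim_lt E' hx).trans_le hc
      obtain ⟨σ, hσ⟩ := exists_isIdemMGU (eqsSubst (Fm.single x t) E')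
        ⟨τ, (unifiesAll_eqsSubst_single hτ.1).2 hτ.2⟩
      exact ⟨_, hσ.elim hx⟩
  obtain ⟨τ, hτ⟩ := h
  match hE : E, hτ with
  | [], _ => exact ⟨.var, by simp, fun τ _ k => by simp [Fm.subst]⟩
  | (.var x, t) :: E', hτ =>
    exact elim x t E' le_rfl (by simp [eqsSize, Fm.size]) ⟨τ, hτ⟩
  | (.i a b, .var x) :: E', hτ =>
    obtain ⟨σ, hσ⟩ := elim x (.i a b) E'
      (by simp [eqsVars, Finset.union_comm, Finset.union_assoc])
      (by simp [eqsSize, Fm.size]) ⟨τ, by rw [unifiesAll_cons] at hτ ⊢; exact ⟨hτ.1.symm, hτ.2⟩⟩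
    exact ⟨σ, hσ.of_iff fun τ => by simp only [unifiesAll_cons, eq_comm]⟩
  | (.n a, .var x) :: E', hτ =>
    obtain ⟨σ, hσ⟩ := elim x (.n a) E'
      (by simp [eqsVars, Finset.union_comm, Finset.union_assoc])
      (by simp [eqsSize, Fm.size]) ⟨τ, by rw [unifiesAll_cons] at hτ ⊢; exact ⟨hτ.1.symm, hτ.2⟩⟩
    exact ⟨σ, hσ.of_iff fun τ => by simp only [unifiesAll_cons, eq_comm]⟩
  | (.i a b, .i c d) :: E', hτ =>
    have key : ∀ τ, UnifiesAll τ ((.i a b, .i c d) :: E') ↔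
        UnifiesAll τ ((a, c) :: (b, d) :: E') := fun τ => by
      simp [Fm.subst, and_assoc]
    have hc : eqsVars ((a, c) :: (b, d) :: E') = eqsVars ((.i a b, .i c d) :: E') := by
      ext y; simp only [eqsVars, List.foldr_cons, Finset.mem_union, Fm.vars]; tauto
    obtain ⟨σ, hσ⟩ := exists_isIdemMGU ((a, c) :: (b, d) :: E') ⟨τ, (key τ).1 hτ⟩
    exact ⟨σ, hσ.of_iff key⟩
  | (.n a, .n b) :: E', hτ =>
    have key : ∀ τ, UnifiesAll τ ((.n a, .n b) :: E') ↔ UnifiesAll τ ((a, b) :: E') :=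
      fun τ => by simp [Fm.subst]
    have hc : eqsVars ((a, b) :: E') = eqsVars ((.n a, .n b) :: E') := rfl
    obtain ⟨σ, hσ⟩ := exists_isIdemMGU ((a, b) :: E') ⟨τ, (key τ).1 hτ⟩
    exact ⟨σ, hσ.of_iff key⟩
  | (.i a b, .n c) :: E', hτ => simp [Fm.subst] at hτ
  | (.n c, .i a b) :: E', hτ => simp [Fm.subst] at hτ
termination_by ((eqsVars E).card, eqsSize E)
decreasing_by
  · exact Prod.lex_def.2 (by simp only; omega)
  · exact Prod.lex_def.2 (by simp only; omega)
  · refine Prod.lex_def.2 (Or.inr ⟨by simp only [hE, hc], by simp [hE, eqsSize, Fm.size]; omega⟩)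
  · refine Prod.lex_def.2 (Or.inr ⟨by simp only [hE, hc], by simp [hE, eqsSize, Fm.size]; omega⟩)

/-! ### Condensed detachment and instances -/

theorem exists_perm_of_injOn {s : Finset ℕ} {f : ℕ → ℕ} (hf : Set.InjOn f s) :
    ∃ p : Equiv.Perm ℕ, ∀ k ∈ s, p k = f k := by
  classical
  obtain ⟨N, hN⟩ : ∃ N, ∀ k ∈ s ∪ s.image f, k < N :=
    ⟨(s ∪ s.image f).sup id + 1, fun k hk => Nat.lt_succ_of_le (Finset.le_sup (f := id) hk)⟩
  have hN1 : ∀ k ∈ s, k < N := fun k hk => hN k (by simp [hk])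
  have hN2 : ∀ k ∈ s, f k < N := fun k hk => hN _ (by simp; exact Or.inr ⟨k, hk, rfl⟩)
  let e : {k : Fin N // (k : ℕ) ∈ s} ≃ {k : Fin N // (k : ℕ) ∈ s.image f} :=
    Equiv.ofBijective
      (fun k => ⟨⟨f k.1, hN2 _ k.2⟩, Finset.mem_image_of_mem f k.2⟩)
      ⟨fun a b h => by
          simp only [Subtype.mk.injEq, Fin.mk.injEq] at h
          exact Subtype.ext (Fin.ext (hf a.2 b.2 h)),
        fun b => by
          obtain ⟨k, hk, e⟩ := Finset.mem_image.1 b.2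
          exact ⟨⟨⟨k, hN1 k hk⟩, hk⟩, Subtype.ext (Fin.ext e)⟩⟩
  refine ⟨(e.extendSubtype).extendDomain (p := fun k => k < N) Fin.equivSubtype, fun k hk => ?_⟩
  rw [Equiv.Perm.extendDomain_apply_subtype (p := fun k => k < N) _ _ (hN1 k hk)]
  have := Equiv.extendSubtype_apply_of_mem e ⟨k, hN1 k hk⟩ hk
  simp only [Fin.equivSubtype, Equiv.coe_fn_symm_mk, Equiv.coe_fn_mk]
  rw [this]
  rfl

theorem alphVar_of_mutual_instances {a b : Fm} {ρ ρ' : ℕ → Fm} (h : b = a.subst ρ)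
    (h' : a = b.subst ρ') : AlphVar a b := by
  have key : ∀ k ∈ a.vars, ∃ m, ρ k = .var m ∧ ρ' m = .var k := by
    intro k hk
    have h2 : a.subst (fun k => (ρ k).subst ρ') = a.subst .var := by
      rw [← Fm.subst_subst, ← h, ← h', Fm.subst_var]
    have h3 := Fm.eq_of_subst_eq h2 k hk
    cases e : ρ k with
    | var m => exact ⟨m, rfl, by simpa [e, Fm.subst] using h3⟩
    | i _ _ => simp [e, Fm.subst] at h3
    | n _ => simp [e, Fm.subst] at h3
  choose! f hf using key
  obtain ⟨p, hp⟩ := exists_perm_of_injOn (s := a.vars) (f := f) fun x hx y hy e => by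
    have h1 := (hf x hx).2
    rw [e, (hf y hy).2] at h1
    exact (Fm.var.inj h1).symm
  refine ⟨p, h.trans (Fm.subst_congr fun k hk => ?_)⟩
  rw [(hf k hk).1, renameSubst, hp k hk]

/-- The involution of `ℕ` exchanging `[0, N)` and `[N, 2N)`. -/
def blockSwap (N : ℕ) : Equiv.Perm ℕ :=
  Function.Involutive.toPerm (fun k => if k < N then k + N else if k < 2 * N then k - N else k)
    fun k => by grind

theorem blockSwap_of_lt {N k : ℕ} (h : k < N) : blockSwap N k = k + N := by
  simp [blockSwap, Function.Involutive.toPerm, h]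

/-- A formula whose instances are exactly the detachments of instances of the two premisses is
a condensed detachment of the premisses. -/
theorem cd_of_instances {A B q c : Fm}
    (h₁ : ∃ τ₁ τ₂, A.subst τ₁ = q.subst τ₂ ∧ c = B.subst τ₁)
    (h₂ : ∀ τ₁ τ₂, A.subst τ₁ = q.subst τ₂ → ∃ ρ, B.subst τ₁ = c.subst ρ) :
    CD (.i A B) q c := by
  obtain ⟨τ₁, τ₂, hτ, hc⟩ := h₁
  obtain ⟨N, hN⟩ : ∃ N, ∀ k ∈ (Fm.i A B).vars ∪ q.vars, k < N :=
    ⟨((Fm.i A B).vars ∪ q.vars).sup id + 1, fun k hk =>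
      Nat.lt_succ_of_le (Finset.le_sup (f := id) hk)⟩
  have hA : ∀ k ∈ A.vars, k < N := fun k hk => hN k (by simp [Fm.vars, hk])
  have hB : ∀ k ∈ B.vars, k < N := fun k hk => hN k (by simp [Fm.vars, hk])
  have hq : ∀ k ∈ q.vars, k < N := fun k hk => hN k (by simp [hk])
  set C := q.subst (renameSubst (blockSwap N)) with hC
  have hCs : ∀ τ : ℕ → Fm, C.subst τ = q.subst fun k => τ (k + N) := fun τ => by
    rw [hC, Fm.subst_subst]
    exact Fm.subst_congr fun k hk => by simp [renameSubst, Fm.subst, blockSwap_of_lt (hq k hk)]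
  let τ : ℕ → Fm := fun k => if k < N then τ₁ k else τ₂ (k - N)
  have hAτ : A.subst τ = A.subst τ₁ := Fm.subst_congr fun k hk => if_pos (hA k hk)
  have hBτ : B.subst τ = B.subst τ₁ := Fm.subst_congr fun k hk => if_pos (hB k hk)
  have hCτ : C.subst τ = q.subst τ₂ := by
    rw [hCs]; exact Fm.subst_congr fun k _ => by simp [τ]
  have hu : UnifiesAll τ [(A, C)] := by simp [hAτ, hCτ, hτ]
  obtain ⟨σ, hσ, hσ'⟩ := exists_isIdemMGU [(A, C)] ⟨τ, hu⟩
  have hσ : A.subst σ = C.subst σ := by simpa using hσ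
  refine ⟨A, B, C, σ, rfl, ⟨_, hC⟩, ?_, ⟨hσ, fun ρ hρ => ⟨ρ, hσ' ρ (unifiesAll_cons.2 ⟨hρ, unifiesAll_nil ρ⟩)⟩⟩, ?_⟩
  · rw [Finset.disjoint_left]
    intro k hk hkC
    have hk' : k < N := hN k (by simp [hk])
    rw [hC, Fm.vars_subst, Finset.mem_biUnion] at hkC
    obtain ⟨j, hj, hjk⟩ := hkC
    simp only [renameSubst, Fm.vars, blockSwap_of_lt (hq j hj), Finset.mem_singleton] at hjk
    omega
  · obtain ⟨ρ, hρ⟩ := h₂ σ _ (hσ.trans (hCs σ))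
    refine alphVar_of_mutual_instances (ρ := τ) (ρ' := ρ) ?_ hρ
    rw [hc, ← hBτ, Fm.subst_subst]
    exact Fm.subst_congr fun k _ => hσ' τ hu k

/-! ### Evaluation of condensed-detachment terms -/

/-- Solve the equations `E`, using at most the given number of steps, and apply the resulting most
general unifier to `B`. -/
def solve : ℕ → List (Fm × Fm) → Fm → Option Fm
  | 0, _, _ => none
  | _ + 1, [], B => some B
  | m + 1, (.var x, t) :: E, B =>
    if t = .var x then solve m E B
    else if t.subst (Fm.single x t) = t then
      solve m (eqsSubst (Fm.single x t) E) (B.subst (Fm.single x t))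
    else none
  | m + 1, (t, .var x) :: E, B => solve m ((.var x, t) :: E) B
  | m + 1, (.i a b, .i c d) :: E, B => solve m ((a, c) :: (b, d) :: E) B
  | m + 1, (.n a, .n b) :: E, B => solve m ((a, b) :: E) B
  | _ + 1, _ :: _, _ => none

theorem solve_spec {m : ℕ} {E : List (Fm × Fm)} {B c : Fm} (h : solve m E B = some c) :
    (∃ τ, UnifiesAll τ E ∧ B.subst τ = c) ∧
      ∀ τ, UnifiesAll τ E → c.subst τ = B.subst τ := by
  induction m, E, B using solve.induct with
  | case1 => simp [solve] at h
  | case2 m B =>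
    simp only [solve, Option.some.injEq] at h
    subst h
    exact ⟨⟨.var, by simp, by simp⟩, fun _ _ => rfl⟩
  | case3 m x E B ih => simpa using ih (by simpa [solve] using h)
  | case4 m x t E B h1 h2 ih =>
    obtain ⟨⟨τ, hτ, hc⟩, h4⟩ := ih (by simpa [solve, h1, h2] using h)
    refine ⟨⟨fun k => (Fm.single x t k).subst τ, ?_, by rw [← Fm.subst_subst, hc]⟩, ?_⟩
    · rw [unifiesAll_cons]
      refine ⟨?_, unifiesAll_eqsSubst.1 hτ⟩
      rw [← Fm.subst_subst, ← Fm.subst_subst, h2]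
      simp [Fm.subst, Fm.single]
    · intro τ hτ
      rw [unifiesAll_cons] at hτ
      rw [h4 τ ((unifiesAll_eqsSubst_single hτ.1).2 hτ.2), Fm.subst_single_subst hτ.1]
  | case5 m x t E B h1 h2 => simp [solve, h1, h2] at h
  | case6 m t x E B ht ih =>
    have h := ih (by simpa [solve] using h)
    simpa only [unifiesAll_cons, eq_comm] using h
  | case7 m a b c d E B ih =>
    have h := ih (by simpa [solve] using h)
    simpa [Fm.subst, and_assoc] using h
  | case8 m a b E B ih =>
    have h := ih (by simpa [solve] using h)
    simpa [Fm.subst] using h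
  | case9 => simp_all [solve]

namespace Fm

/-- Whether a formula contains no double negation. -/
def dnFree : Fm → Bool
  | var _ => true
  | i a b => dnFree a && dnFree b
  | n (n _) => false
  | n a => dnFree a

/-- The variables of a formula in order of first occurrence. -/
def varList : Fm → List ℕ
  | var k => [k]
  | i a b => varList a ++ (varList b).filter fun k => !(varList a).contains k
  | n a => varList a

/-- The alphabetic variant of a formula whose variables are numbered by first occurrence. -/
def normalize (a : Fm) : Fm := a.subst fun k => var (a.varList.idxOf k)

end Fm

/-- The condensed detachment of `i A B` and `q`, if it exists and contains no double negation. -/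
def detach (A B q : Fm) : Option Fm :=
  match solve 1000 [(A.subst fun k => .var (2 * k), q.subst fun k => .var (2 * k + 1))]
      (B.subst fun k => .var (2 * k)) with
  | none => none
  | some c =>
    if c.normalize.dnFree ∧ c.normalize.subst (fun k => .var (c.varList.getD k 0)) = c then
      some c.normalize
    else none

theorem cd_of_detach {A B q c : Fm} (h : detach A B q = some c) :
    CD (.i A B) q c ∧ c.dnFree := by
  unfold detach at h
  split at h
  · cases h
  · rename_i c₀ h₀
    split_ifs at h with h₁
    obtain ⟨⟨τ, hτ, hc⟩, h₂⟩ := solve_spec h₀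
    obtain rfl := Option.some.inj h
    refine ⟨cd_of_instances ?_ fun τ₁ τ₂ h₃ => ?_, h₁.1⟩
    · have h₄ := (unifiesAll_cons.1 hτ).1
      rw [Fm.subst_subst, Fm.subst_subst] at h₄
      let π : ℕ → Fm := fun k => .var (c₀.varList.idxOf k)
      refine ⟨fun k => (τ (2 * k)).subst π, fun k => (τ (2 * k + 1)).subst π, ?_, ?_⟩
      · rw [← Fm.subst_subst, ← Fm.subst_subst]
        exact congrArg (Fm.subst π) h₄
      · rw [← Fm.subst_subst, Fm.normalize]
        rw [Fm.subst_subst] at hc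
        exact congrArg (Fm.subst π) hc.symm
    · have h₄ := h₂ (fun k => if k % 2 = 0 then τ₁ (k / 2) else τ₂ (k / 2)) (by
        rw [unifiesAll_cons, Fm.subst_subst, Fm.subst_subst]
        refine ⟨?_, unifiesAll_nil _⟩
        simp only [Fm.subst]
        convert h₃ using 3 with k k
        · simp
        · have e : (2 * k + 1) / 2 = k := by omega
          simp [e])
      rw [← h₁.2, Fm.subst_subst, Fm.subst_subst (a := B)] at h₄
      simp only [Fm.subst, Nat.mul_mod_right, if_true, Nat.mul_div_cancel_left _ two_pos] at h₄
      exact ⟨_, h₄.symm⟩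

/-- Condensed-detachment terms over the axioms `A1`-`A4`. -/
inductive DTerm : Type
  | a1 | a2 | a3 | a4
  | d (s t : DTerm)

namespace DTerm

/-- The formula proved by a condensed-detachment term, provided that it is defined and that no
deduced step contains a double negation. -/
def value : DTerm → Option Fm
  | a1 => some A1
  | a2 => some A2
  | a3 => some A3
  | a4 => some A4
  | d s t =>
    match value s, value t with
    | some (.i A B), some q => detach A B q
    | _, _ => none

theorem cdProof_of_value {G : Fm → Prop} (hG : ∀ f : Fm, f.dnFree → G f) {t : DTerm} {c : Fm}
    (h : t.value = some c) : CDProof Aax G c := by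
  have ax : ∀ a ∈ Aax, CDProof Aax G a := fun a ha => .ax ha ⟨1, (Fm.subst_var a).symm⟩
  induction t generalizing c with
  | a1 => exact Option.some.inj h ▸ ax A1 (by simp [Aax])
  | a2 => exact Option.some.inj h ▸ ax A2 (by simp [Aax])
  | a3 => exact Option.some.inj h ▸ ax A3 (by simp [Aax])
  | a4 => exact Option.some.inj h ▸ ax A4 (by simp [Aax])
  | d s t ihs iht =>
    simp only [value] at h
    split at h
    · rename_i A B q hs ht
      exact .cd (ihs hs) (iht ht) (cd_of_detach h).1 (hG c (cd_of_detach h).2)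
    · cases h

/-- From `i(a,b)` and `i(b,c)`, infer `i(a,c)`. -/
def comp (s t : DTerm) : DTerm := d (d a2 s) t

/-- `i(x,i(i(x,y),y))` -/
def assertion : DTerm := comp a1 a3

/-- `i(i(x,i(y,z)),i(y,i(x,z)))` -/
def exchange : DTerm := comp a2 (d a2 assertion)

/-- Exchange the first two antecedents. -/
def flip (s : DTerm) : DTerm := d exchange s

/-- From `i(a,b)`, infer `i(i(x,a),i(x,b))`. -/
def under (s : DTerm) : DTerm := d (flip a2) s

/-- `i(x,i(y,y))` -/
def weakId : DTerm := flip a1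

/-- `i(x,x)` -/
def ident : DTerm := d weakId a1

/-- `i(i(x,y),i(y,y))` -/
def rightId : DTerm := flip (comp assertion a3)

/-- `i(i(x,i(y,y)),i(i(x,x),i(y,y)))` -/
def transfer : DTerm :=
  flip (d (flip (comp (comp (flip a2) (d a2 assertion)) (under a3))) ident)

/-- `i(i(x,x),i(x,x))` -/
def doubleId : DTerm := d transfer a1

/-- `i(n(x),i(x,y))` -/
def exFalso : DTerm := comp a1 a4

/-- `i(i(n(x),n(i(z,z))),x)` -/
def byContra : DTerm := d (flip a4) ident

/-- `i(i(x,n(i(z,z))),n(x))` -/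
def negIntro : DTerm := comp (d a2 byContra) (d (flip a3) (d (flip exFalso) ident))

/-- The axiom `A6`. -/
def a6 : DTerm := comp (comp a2 (under negIntro)) (d a2 exFalso)

/-- The axiom `A7`. -/
def a7 : DTerm := comp (comp a2 (under byContra)) (d a2 exFalso)

/-- The axiom `A8`. -/
def a8 : DTerm := comp (comp (under exFalso) exchange) (under negIntro)

/-- `i(i(x,y),i(x,x))` -/
def leftId : DTerm := comp (comp a6 rightId) a4

/-- `i(i(i(x,y),i(x,y)),i(x,x))` -/
def projLeft : DTerm := d transfer leftId

/-- `i(i(i(x,y),i(x,y)),i(y,y))` -/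
def projRight : DTerm := d transfer rightId

/-- `i(i(i(x,x),y),i(i(i(x,z),i(x,z)),y))` -/
def extendLeft : DTerm := d a2 projLeft

/-- `i(i(i(x,x),y),i(i(i(x,z),i(x,z)),i(z,z)))` -/
def extendRight : DTerm := comp extendLeft (comp leftId (under projRight))

/-- `i(i(x,i(y,y)),i(x,i(n(y),n(y))))` -/
def negId : DTerm := under (comp doubleId a6)

/-- `i(i(x,x),i(i(y,y),i(i(x,y),i(x,y))))` -/
def impId : DTerm :=
  flip (comp doubleId (flip (comp doubleId (comp (comp a2 a2) (d a2 (flip a2))))))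

/-- `i(i(x,i(x,i(y,y))),i(x,i(y,y)))` -/
def contractId : DTerm :=
  d (flip (comp (comp (comp (comp a1 rightId) (under exchange)) doubleId) projRight)) weakId

/-- `i(i(x,i(y,y)),i(i(x,i(z,z)),i(x,i(i(y,z),i(y,z)))))` -/
def impIdUnder : DTerm :=
  comp (comp (comp (under impId) exchange) (flip a2)) (under contractId)

end DTerm

/-! ### Substitution instances -/

/-- Every double negation occurring in `f` occurs in `T`. -/
def Good (T f : Fm) : Prop := ∀ t : Fm, Fm.Sub (.n (.n t)) f → Fm.Sub (.n (.n t)) T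

theorem Fm.Sub.trans {a b c : Fm} (h : Fm.Sub a b) (h' : Fm.Sub b c) : Fm.Sub a c := by
  induction h' with
  | refl => exact h
  | il _ ih => exact .il ih
  | ir _ ih => exact .ir ih
  | neg _ ih => exact .neg ih

section Good

variable {T : Fm}

@[simp] theorem good_var (k : ℕ) : Good T (.var k) := fun _ h => nomatch h

@[simp] theorem good_i {a b : Fm} : Good T (.i a b) ↔ Good T a ∧ Good T b :=
  ⟨fun h => ⟨fun t ht => h t (.il ht), fun t ht => h t (.ir ht)⟩, fun h t ht => by
    cases ht with
    | il ht => exact h.1 t ht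
    | ir ht => exact h.2 t ht⟩

theorem Good.of_n {a : Fm} (h : Good T (.n a)) : Good T a := fun t ht => h t (.neg ht)

theorem Good.n {a : Fm} (h : Good T a) (h' : ∀ c, a = .n c → Fm.Sub (.n (.n c)) T) :
    Good T (.n a) := fun t ht => by
  cases ht with
  | refl => exact h' t rfl
  | neg ht => exact h t ht

theorem good_of_dnFree {f : Fm} (h : f.dnFree) : Good T f := by
  induction f with
  | var k => simp
  | i a b iha ihb =>
    simp only [Fm.dnFree, Bool.and_eq_true] at h
    exact good_i.2 ⟨iha h.1, ihb h.2⟩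
  | n a ih =>
    cases a with
    | n b => simp [Fm.dnFree] at h
    | var k => exact (ih h).n (by simp)
    | i a b => exact (ih h).n (by simp)

/-- Provability from `A1`-`A4` by condensed detachment with deduced steps containing no double
negations other than those of `T`. -/
def GoodProvable (T f : Fm) : Prop := CDProof Aax (Good T) f

theorem goodProvable_of_value (t : DTerm) {c : Fm} (h : t.value = some c) : GoodProvable T c :=
  DTerm.cdProof_of_value (fun _ => good_of_dnFree) h

theorem GoodProvable.mp {a b : Fm} (h : GoodProvable T (.i a b)) (ha : GoodProvable T a)
    (hb : Good T b) : GoodProvable T b :=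
  .cd h ha (cd_of_instances ⟨.var, .var, rfl, (Fm.subst_var b).symm⟩ fun τ _ _ => ⟨τ, rfl⟩) hb

/-- `i(i(v,v),i(t,t))` is provable. -/
def IdProvable (T v t : Fm) : Prop := GoodProvable T (.i (.i v v) (.i t t))

theorem IdProvable.extendLeft {v : Fm} {x y : ℕ} (h : IdProvable T v (.var x)) (hv : Good T v)
    (hx : x ≠ y) (hy : y ∉ v.vars) : IdProvable T (.i v (.var y)) (.var x) := by
  have h₁ : GoodProvable T (.i (.i (.i (.var 0) (.var 0)) (.var 1))
      (.i (.i (.i (.var 0) (.var 2)) (.i (.var 0) (.var 2))) (.var 1))) :=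
    goodProvable_of_value .extendLeft (by decide +kernel)
  refine .cd h₁ h (cd_of_instances ?_ fun τ₁ τ₂ e => ?_) (by simp [hv])
  · exact ⟨fun k => match k with
      | 0 => v
      | 1 => .i (.var x) (.var x)
      | _ => .var y, .var, by simp [Fm.subst], by simp [Fm.subst]⟩
  · simp only [Fm.subst, Fm.i.injEq] at e
    refine ⟨fun k => if k = y then τ₁ 2 else τ₂ k, ?_⟩
    have hv' : v.subst (fun k => if k = y then τ₁ 2 else τ₂ k) = v.subst τ₂ :=
      Fm.subst_congr fun k hk => if_neg (by rintro rfl; exact hy hk)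
    simp [Fm.subst, hv', e, hx]

theorem IdProvable.extendRight {v : Fm} {x y : ℕ} (h : IdProvable T v (.var x)) (hv : Good T v)
    (hy : y ∉ v.vars) : IdProvable T (.i v (.var y)) (.var y) := by
  have h₁ : GoodProvable T (.i (.i (.i (.var 0) (.var 0)) (.var 1))
      (.i (.i (.i (.var 0) (.var 2)) (.i (.var 0) (.var 2))) (.i (.var 2) (.var 2)))) :=
    goodProvable_of_value .extendRight (by decide +kernel)
  refine .cd h₁ h (cd_of_instances ?_ fun τ₁ τ₂ e => ?_) (by simp [hv])
  · exact ⟨fun k => match k with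
      | 0 => v
      | 1 => .i (.var x) (.var x)
      | _ => .var y, .var, by simp [Fm.subst], by simp [Fm.subst]⟩
  · simp only [Fm.subst, Fm.i.injEq] at e
    refine ⟨fun k => if k = y then τ₁ 2 else τ₂ k, ?_⟩
    have hv' : v.subst (fun k => if k = y then τ₁ 2 else τ₂ k) = v.subst τ₂ :=
      Fm.subst_congr fun k hk => if_neg (by rintro rfl; exact hy hk)
    simp [Fm.subst, hv', e]

theorem IdProvable.neg {v a : Fm} (h : IdProvable T v a) (hv : Good T v) (ha : Good T (.n a)) :
    IdProvable T v (.n a) := by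
  have h₁ : GoodProvable T (.i (.i (.var 0) (.i (.var 1) (.var 1)))
      (.i (.var 0) (.i (.n (.var 1)) (.n (.var 1))))) :=
    goodProvable_of_value .negId (by decide +kernel)
  refine .cd h₁ h (cd_of_instances ?_ fun τ₁ τ₂ e => ?_) (by simp [hv, ha])
  · exact ⟨fun k => match k with
      | 0 => .i v v
      | _ => a, .var, by simp [Fm.subst], by simp [Fm.subst]⟩
  · simp only [Fm.subst, Fm.i.injEq] at e
    exact ⟨τ₂, by simp [Fm.subst, e]⟩

theorem IdProvable.imp {v a b : Fm} (ha : IdProvable T v a) (hb : IdProvable T v b)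
    (hbv : b.vars ⊆ v.vars) (gv : Good T v) (ga : Good T a) (gb : Good T b) :
    IdProvable T v (.i a b) := by
  have h₁ : GoodProvable T (.i (.i (.var 0) (.i (.var 1) (.var 1)))
      (.i (.i (.var 0) (.i (.var 2) (.var 2)))
        (.i (.var 0) (.i (.i (.var 1) (.var 2)) (.i (.var 1) (.var 2)))))) :=
    goodProvable_of_value .impIdUnder (by decide +kernel)
  obtain ⟨y, hy⟩ := Infinite.exists_notMem_finset (v.vars ∪ a.vars)
  have hyv : y ∉ v.vars := fun h => hy (by simp [h])
  have hya : y ∉ a.vars := fun h => hy (by simp [h])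
  have fresh : ∀ (w s : Fm) (σ : ℕ → Fm), y ∉ w.vars →
      w.subst (fun k => if k = y then s else σ k) = w.subst σ := fun w s σ hw =>
    Fm.subst_congr fun k hk => if_neg (by rintro rfl; exact hw hk)
  have h₂ : GoodProvable T (.i (.i (.i v v) (.i (.var y) (.var y)))
      (.i (.i v v) (.i (.i a (.var y)) (.i a (.var y))))) := by
    refine .cd h₁ ha (cd_of_instances ?_ fun τ₁ τ₂ e => ?_) (by simp [gv, ga])
    · exact ⟨fun k => match k with
        | 0 => .i v v
        | 1 => a
        | _ => .var y, .var, by simp [Fm.subst], by simp [Fm.subst]⟩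
    · simp only [Fm.subst, Fm.i.injEq] at e
      exact ⟨fun k => if k = y then τ₁ 2 else τ₂ k, by
        simp [Fm.subst, fresh v _ _ hyv, fresh a _ _ hya, e]⟩
  refine .cd h₂ hb (cd_of_instances ?_ fun τ₁ τ₂ e => ?_) (by simp [gv, ga, gb])
  · exact ⟨fun k => if k = y then b else .var k, .var, by
      simp [Fm.subst, fresh v _ _ hyv], by
      simp [Fm.subst, fresh v _ _ hyv, fresh a _ _ hya]⟩
  · simp only [Fm.subst, Fm.i.injEq] at e
    have hb' : b.subst τ₁ = b.subst τ₂ :=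
      Fm.subst_congr fun k hk => Fm.eq_of_subst_eq e.1.1 k (hbv hk)
    exact ⟨τ₁, by simp [Fm.subst, hb', e]⟩

/-- A linear implicational formula in the variables `0, …, m`. -/
def comb : ℕ → Fm
  | 0 => .var 0
  | m + 1 => .i (comb m) (.var (m + 1))

theorem mem_vars_comb {m k : ℕ} : k ∈ (comb m).vars ↔ k ≤ m := by
  induction m with
  | zero => simp [comb, Fm.vars]
  | succ m ih => simp only [comb, Fm.vars, Finset.mem_union, ih, Finset.mem_singleton]; omega

@[simp] theorem good_comb (m : ℕ) : Good T (comb m) := by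
  induction m with
  | zero => simp [comb]
  | succ m ih => simp [comb, ih]

theorem idProvable_comb_var {m k : ℕ} (h : k ≤ m) : IdProvable T (comb m) (.var k) := by
  induction m generalizing k with
  | zero =>
    obtain rfl : k = 0 := by omega
    exact goodProvable_of_value .doubleId (by decide +kernel)
  | succ m ih =>
    have hm : m + 1 ∉ (comb m).vars := by rw [mem_vars_comb]; omega
    by_cases hk : k = m + 1
    · subst hk
      exact (ih m.zero_le).extendRight (good_comb m) hm
    · exact (ih (by omega)).extendLeft (good_comb m) hk hm

theorem idProvable_comb {m : ℕ} {t : Fm} (ht : ∀ k ∈ t.vars, k ≤ m) (gt : Good T t) :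
    IdProvable T (comb m) t := by
  induction t with
  | var k => exact idProvable_comb_var (ht k (by simp [Fm.vars]))
  | i a b iha ihb =>
    rw [good_i] at gt
    have hb : ∀ k ∈ b.vars, k ≤ m := fun k hk => ht k (by simp [Fm.vars, hk])
    exact (iha (fun k hk => ht k (by simp [Fm.vars, hk])) gt.1).imp (ihb hb gt.2)
      (fun k hk => mem_vars_comb.2 (hb k hk)) (good_comb m) gt.1 gt.2
  | n a iha => exact (iha ht gt.of_n).neg (good_comb m) gt

theorem goodProvable_i_self {t : Fm} (gt : Good T t) : GoodProvable T (.i t t) := by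
  have h₁ : IdProvable T (comb (t.vars.sup id)) t :=
    idProvable_comb (fun k hk => Finset.le_sup (f := id) hk) gt
  have h₂ : GoodProvable T (.i (.var 0) (.var 0)) :=
    goodProvable_of_value .ident (by decide +kernel)
  exact .cd h₁ h₂ (cd_of_instances ⟨.var, fun _ => comb (t.vars.sup id), by simp [Fm.subst],
    by simp⟩ fun τ _ _ => ⟨τ, rfl⟩) (by simp [gt])

theorem GoodProvable.subst {p : Fm} (h : GoodProvable T p) {σ : ℕ → Fm}
    (hg : Good T (p.subst σ)) : GoodProvable T (p.subst σ) :=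
  .cd (goodProvable_i_self hg) h
    (cd_of_instances ⟨.var, σ, by simp, by simp⟩ fun τ _ _ => ⟨τ, rfl⟩) hg

/-! ### Elimination of double negations -/

open Classical in
/-- Negate a formula, cancelling the resulting double negation if it does not occur in `T`. -/
noncomputable def negCancel (T : Fm) : Fm → Fm
  | .n c => if Fm.Sub (.n (.n c)) T then .n (.n c) else c
  | a => .n a

/-- Erase the doubly negated subformulas selected by `S` and those that would not occur in `T`. -/
noncomputable def eraseExtra (T : Fm) (S : Finset Fm) : Fm → Fm
  | .var k => .var k
  | .i a b => .i (eraseExtra T S a) (eraseExtra T S b)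
  | .n (.var k) => .n (.var k)
  | .n (.i a b) => .n (.i (eraseExtra T S a) (eraseExtra T S b))
  | .n (.n q) => if q ∈ S then eraseExtra T S q else negCancel T (eraseExtra T S (.n q))

theorem negCancel_cases (a : Fm) :
    negCancel T a = .n a ∨ a = .n (negCancel T a) := by
  cases a with
  | n c => simp only [negCancel]; split_ifs <;> simp
  | _ => simp [negCancel]

theorem Good.negCancel {a : Fm} (h : Good T a) : Good T (negCancel T a) := by
  cases a with
  | n c =>
    simp only [_root_.negCancel]
    split_ifs with hc
    · exact h.n (by simpa using hc)
    · exact h.of_n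
  | _ => exact h.n (by simp)

theorem eraseExtra_n_cases (S : Finset Fm) (a : Fm) :
    eraseExtra T S (.n a) = .n (eraseExtra T S a) ∨
      eraseExtra T S a = .n (eraseExtra T S (.n a)) := by
  induction a with
  | n q ih =>
    by_cases hq : q ∈ S
    · simpa [eraseExtra, hq] using ih.symm
    · simpa [eraseExtra, hq] using negCancel_cases _
  | _ => simp [eraseExtra]

theorem good_eraseExtra_aux (S : Finset Fm) (a : Fm) :
    Good T (eraseExtra T S a) ∧ Good T (eraseExtra T S (.n a)) := by
  induction a with
  | var k => simpa [eraseExtra] using (good_var k).n (by simp)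
  | i a b iha ihb =>
    have h : Good T (.i (eraseExtra T S a) (eraseExtra T S b)) := good_i.2 ⟨iha.1, ihb.1⟩
    simpa only [eraseExtra] using ⟨h, h.n (by simp)⟩
  | n q ih =>
    refine ⟨ih.2, ?_⟩
    unfold eraseExtra
    split_ifs
    exacts [ih.1, ih.2.negCancel]

theorem good_eraseExtra (S : Finset Fm) (a : Fm) : Good T (eraseExtra T S a) :=
  (good_eraseExtra_aux S a).1

theorem eraseExtra_eq_eraseDN {S : Finset Fm} {f : Fm} (h : Fm.Sub (eraseDN S f) T) :
    eraseExtra T S f = eraseDN S f := by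
  induction f using eraseDN.induct S with
  | case1 => rfl
  | case2 a b iha ihb =>
    simp only [eraseDN] at h
    simp only [eraseDN, eraseExtra, iha (.trans (.il (.refl _)) h), ihb (.trans (.ir (.refl _)) h)]
  | case3 => rfl
  | case4 a b iha ihb =>
    simp only [eraseDN] at h
    simp only [eraseDN, eraseExtra, iha (.trans (.neg (.il (.refl _))) h),
      ihb (.trans (.neg (.ir (.refl _))) h)]
  | case5 q hq ih =>
    simp only [eraseDN, hq, if_true] at h
    simp only [eraseDN, eraseExtra, hq, if_true, ih h]
  | case6 q hq ih =>
    simp only [eraseDN, hq, if_false] at h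
    simp only [eraseDN, eraseExtra, hq, if_false, ih (.trans (.neg (.refl _)) h)]
    cases e : eraseDN S (.n q) with
    | n c => rw [e] at h; simp [negCancel, h]
    | _ => rfl

/-- The substitution `0 ↦ a, 1 ↦ b, k ↦ c` for `k > 1`. -/
def subst₃ (a b c : Fm) : ℕ → Fm
  | 0 => a
  | 1 => b
  | _ => c

theorem goodProvable_eraseExtra_ax (S : Finset Fm) {a : Fm} (ha : a ∈ Aax) (σ : ℕ → Fm) :
    GoodProvable T (eraseExtra T S (a.subst σ)) := by
  have g := good_eraseExtra (T := T) S
  have ax : ∀ b ∈ Aax, GoodProvable T b := fun b hb => .ax hb ⟨1, (Fm.subst_var b).symm⟩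
  have h₁ : GoodProvable T A1 := ax A1 (by simp [Aax])
  have h₂ : GoodProvable T A2 := ax A2 (by simp [Aax])
  have h₃ : GoodProvable T A3 := ax A3 (by simp [Aax])
  have h₄ : GoodProvable T A4 := ax A4 (by simp [Aax])
  have h₆ : GoodProvable T A6 := goodProvable_of_value .a6 (by decide +kernel)
  have h₇ : GoodProvable T A7 := goodProvable_of_value .a7 (by decide +kernel)
  have h₈ : GoodProvable T A8 := goodProvable_of_value .a8 (by decide +kernel)
  simp only [Aax, Set.mem_insert_iff, Set.mem_singleton_iff] at ha
  rcases ha with rfl | rfl | rfl | rfl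
  · exact h₁.subst (σ := fun k => eraseExtra T S (σ k)) (g (A1.subst σ))
  · exact h₂.subst (σ := fun k => eraseExtra T S (σ k)) (g (A2.subst σ))
  · exact h₃.subst (σ := fun k => eraseExtra T S (σ k)) (g (A3.subst σ))
  · have hg := g (A4.subst σ)
    simp only [A4, Fm.subst, eraseExtra] at hg ⊢
    rcases eraseExtra_n_cases (T := T) S (σ 0) with hx | hx <;>
      rcases eraseExtra_n_cases (T := T) S (σ 1) with hy | hy <;>
      rw [hx, hy] at hg ⊢
    · exact h₄.subst (σ := subst₃ _ _ (.var 0)) hg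
    · exact h₇.subst (σ := subst₃ _ _ (.var 0)) hg
    · exact h₈.subst (σ := subst₃ _ _ (.var 0)) hg
    · exact h₆.subst (σ := subst₃ _ _ (.var 0)) hg

theorem CDProvable.goodProvable_eraseExtra {B : Fm} (h : CDProvable Aax B) (S : Finset Fm)
    (σ : ℕ → Fm) : GoodProvable T (eraseExtra T S (B.subst σ)) := by
  unfold CDProvable at h
  induction h generalizing σ with
  | ax ha h =>
    obtain ⟨p, rfl⟩ := h
    rw [Fm.subst_subst]
    exact goodProvable_eraseExtra_ax S ha _
  | cd hp hq h _ ihp ihq =>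
    obtain ⟨A, B, C, σ', rfl, ⟨p, rfl⟩, -, ⟨hu, -⟩, ⟨p', rfl⟩⟩ := h
    rw [Fm.subst_subst, Fm.subst_subst]
    have h₁ := ihp fun k => ((σ' k).subst (renameSubst p')).subst σ
    have h₂ := ihq fun k => (((renameSubst p k).subst σ').subst (renameSubst p')).subst σ
    have h₃ := congrArg (fun f => (f.subst (renameSubst p')).subst σ) hu
    simp only [Fm.subst_subst, Fm.subst, eraseExtra] at h₁ h₂ h₃ ⊢
    rw [← h₃] at h₂
    exact h₁.mp h₂ (good_eraseExtra S _)

theorem CDProof.mono {L : Set Fm} {G G' : Fm → Prop} (hG : ∀ f, G f → G' f) {f : Fm}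
    (h : CDProof L G f) : CDProof L G' f := by
  induction h with
  | ax ha h => exact .ax ha h
  | cd _ _ h hc ihp ihq => exact .cd ihp ihq h (hG _ hc)

end Good

/-- The axiom system A1-A4 of Łukasiewicz's infinite-valued sentential calculus,
with condensed detachment as the sole rule of inference, admits strong
double-negation elimination. -/
theorem stmt14 : StrongDNE Aax := by
  intro B S hB _
  have h := hB.goodProvable_eraseExtra (T := eraseDN S B) S .var
  rw [Fm.subst_var, eraseExtra_eq_eraseDN (.refl _)] at h
  exact h.mono fun f hf t ht => ⟨t, hf t ht, 1, (Fm.subst_var t).symm⟩
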